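/- Suppose G_0, G_1, …, G_m is a chain decomposition of a multigraph G rooted at r, and let 1 ≤ i ≤ m. If e is a cut edge of H_i, then the chain of the decomposition containing e is a one-way chain (consisting of the single edge e), and one of the two components of H_i − e contains exactly one vertex and no edges. The same conclusion holds for cut edges of Hbar_{i−1}. -/

import Mathlib

set_option autoImplicit false

/-- A multigraph: a type of vertices, a type of edges, and a map assigning to each
edge its unordered pair of endpoints (a loop has endpoints `s(v, v)`). -/
structure MG : Type 1 where
  V : Type
  E : Type
  ends : E → Sym2 V

namespace MG

variable (G : MG)

/-- The set of vertices covered by a set `F` of edges. -/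
def vertsOf (F : Set G.E) : Set G.V := {v | ∃ e ∈ F, v ∈ G.ends e}

/-- The degree of a vertex `v` with respect to a set `F` of edges;
a loop contributes two to the degree. -/
noncomputable def deg (F : Set G.E) (v : G.V) : ℕ :=
  {e ∈ F | v ∈ G.ends e}.ncard + {e ∈ F | G.ends e = s(v, v)}.ncard

/-- `G` has no isolated vertices. -/
def NoIsolated : Prop := ∀ v : G.V, ∃ e : G.E, v ∈ G.ends e

/-- `IsLink vs es`: the edge list `es` successively links the consecutive
vertices of the vertex list `vs`. -/
def IsLink : List G.V → List G.E → Prop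
  | [_], [] => True
  | a :: b :: vs, e :: es => G.ends e = s(a, b) ∧ IsLink (b :: vs) es
  | _, _ => False

/-- `vs, es` form a (simple) path: distinct vertices, distinct edges, consecutive linking. -/
def IsPath (vs : List G.V) (es : List G.E) : Prop :=
  vs.Nodup ∧ es.Nodup ∧ G.IsLink vs es

/-- `v :: vs, es` form a (simple) cycle through the basepoint `v`:
the distinct vertices `v :: vs` are linked cyclically by the distinct edges `es`.
A loop gives a cycle of length one and two parallel edges give a cycle of length two. -/
def IsCycle (v : G.V) (vs : List G.V) (es : List G.E) : Prop :=
  (v :: vs).Nodup ∧ es.Nodup ∧ es ≠ [] ∧ G.IsLink (v :: (vs ++ [v])) es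

/-- Reachability using only edges from `F`. -/
def Reach (F : Set G.E) : G.V → G.V → Prop :=
  Relation.ReflTransGen (fun a b => ∃ e ∈ F, G.ends e = s(a, b))

/-- `G` with edge set restricted to `F` is connected as a graph on all of `G.V`. -/
def ConnectedOn (F : Set G.E) : Prop := ∀ a b : G.V, G.Reach F a b

/-- The subgraph formed by the edge set `F` together with the vertices it covers
is connected. -/
def ConnectedWithin (F : Set G.E) : Prop :=
  ∀ a ∈ G.vertsOf F, ∀ b ∈ G.vertsOf F, G.Reach F a b

/-- `G` is 4-edge-connected: at least two vertices, and deleting any set of fewer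
than four edges leaves the graph connected. -/
def FourEdgeConnected : Prop :=
  2 ≤ Nat.card G.V ∧ ∀ S : Set G.E, S.Finite → S.ncard < 4 → G.ConnectedOn Sᶜ

/-- `e` is a cut edge of the subgraph formed by the edge set `F`: removing `e`
disconnects two vertices of that subgraph. -/
def IsCutEdge (F : Set G.E) (e : G.E) : Prop :=
  e ∈ F ∧ ∃ a ∈ G.vertsOf F, ∃ b ∈ G.vertsOf F, ¬ G.Reach (F \ {e}) a b

/-! ### Chains -/

/-- An open up chain with respect to `(H, Hb)`, rooted at `r`: a path with at least
one edge, edge-disjoint from `H` and `Hb`, in which every vertex is `r` or has degree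
at least two in `Hb`, and whose ends are `r` or lie in `H`. -/
def IsOpenUpChain (r : G.V) (H Hb C : Set G.E) : Prop :=
  Disjoint C H ∧ Disjoint C Hb ∧
  ∃ vs es, G.IsPath vs es ∧ es ≠ [] ∧ C = {e | e ∈ es} ∧
    (∀ v ∈ vs, v = r ∨ 2 ≤ G.deg Hb v) ∧
    (∀ v, vs.head? = some v → v = r ∨ v ∈ G.vertsOf H) ∧
    (∀ v, vs.getLast? = some v → v = r ∨ v ∈ G.vertsOf H)

/-- A closed up chain with respect to `(H, Hb)`, rooted at `r`, with common end `v`: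
a cycle through `v`, edge-disjoint from `H` and `Hb`, in which every vertex is `r` or
has degree at least two in `Hb`, and the end `v` is `r` or has degree at least two in `H`. -/
def IsClosedUpChain (r : G.V) (H Hb C : Set G.E) (v : G.V) : Prop :=
  Disjoint C H ∧ Disjoint C Hb ∧
  ∃ vs es, G.IsCycle v vs es ∧ C = {e | e ∈ es} ∧
    (∀ u ∈ v :: vs, u = r ∨ 2 ≤ G.deg Hb u) ∧
    (v = r ∨ 2 ≤ G.deg H v)

/-- An up chain with respect to `(H, Hb)`. -/
def IsUpChain (r : G.V) (H Hb C : Set G.E) : Prop :=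
  G.IsOpenUpChain r H Hb C ∨ ∃ v, G.IsClosedUpChain r H Hb C v

/-- A down chain with respect to `(H, Hb)` is an up chain with respect to `(Hb, H)`. -/
def IsDownChain (r : G.V) (H Hb C : Set G.E) : Prop := G.IsUpChain r Hb H C

/-- A closed down chain with respect to `(H, Hb)` with common end `v`. -/
def IsClosedDownChain (r : G.V) (H Hb C : Set G.E) (v : G.V) : Prop :=
  G.IsClosedUpChain r Hb H C v

/-- A one-way chain with respect to `(H, Hb)`, with tail `u` and head `v`:
a single edge `e ∉ H ∪ Hb` with ends `u` and `v`, where the tail `u` is `r` or has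
degree at least two in `H`, and the head `v` is `r` or has degree at least two in `Hb`. -/
def IsOneWayChainAt (r : G.V) (H Hb C : Set G.E) (u v : G.V) : Prop :=
  ∃ e, e ∉ H ∧ e ∉ Hb ∧ C = {e} ∧ G.ends e = s(u, v) ∧
    (u = r ∨ 2 ≤ G.deg H u) ∧ (v = r ∨ 2 ≤ G.deg Hb v)

/-- A one-way chain with respect to `(H, Hb)`. -/
def IsOneWayChain (r : G.V) (H Hb C : Set G.E) : Prop :=
  ∃ u v, G.IsOneWayChainAt r H Hb C u v

/-- A chain with respect to `(H, Hb)`: an up chain, a down chain, or a one-way chain. -/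
def IsChain (r : G.V) (H Hb C : Set G.E) : Prop :=
  G.IsUpChain r H Hb C ∨ G.IsDownChain r H Hb C ∨ G.IsOneWayChain r H Hb C

/-- `H_i`: the union of the chains with index `< i`. -/
def before {n : ℕ} (Gs : Fin n → Set G.E) (i : Fin n) : Set G.E :=
  {e | ∃ j, j < i ∧ e ∈ Gs j}

/-- `Hbar_i`: the union of the chains with index `> i`. -/
def after {n : ℕ} (Gs : Fin n → Set G.E) (i : Fin n) : Set G.E :=
  {e | ∃ j, i < j ∧ e ∈ Gs j}

/-- `Gs` is a chain decomposition, rooted at `r`, of the part of `G` with edge set `F`: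
the `Gs i` partition `F`, and each `Gs i` is an up chain, a down chain or a one-way
chain with respect to `(H_i, Hbar_i)`. -/
def IsChainDecompOn (F : Set G.E) (r : G.V) {n : ℕ} (Gs : Fin n → Set G.E) : Prop :=
  (∀ i j, i ≠ j → Disjoint (Gs i) (Gs j)) ∧ (⋃ i, Gs i) = F ∧
  ∀ i, G.IsChain r (G.before Gs i) (G.after Gs i) (Gs i)

/-- `Gs` is a chain decomposition of `G` rooted at `r`. -/
def IsChainDecomp (r : G.V) {n : ℕ} (Gs : Fin n → Set G.E) : Prop :=
  G.IsChainDecompOn Set.univ r Gs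

/-- `G` has a chain decomposition rooted at `r`. -/
def HasChainDecomp (r : G.V) : Prop :=
  ∃ (m : ℕ) (Gs : Fin (m + 1) → Set G.E), G.IsChainDecomp r Gs

/-- A minimal open up chain: an open up chain none of whose internal vertices
lies in `{r} ∪ V(H)`. -/
def IsMinimalOpenUpChain (r : G.V) (H Hb C : Set G.E) : Prop :=
  Disjoint C H ∧ Disjoint C Hb ∧
  ∃ vs es, G.IsPath vs es ∧ es ≠ [] ∧ C = {e | e ∈ es} ∧
    (∀ v ∈ vs, v = r ∨ 2 ≤ G.deg Hb v) ∧
    (∀ v, vs.head? = some v → v = r ∨ v ∈ G.vertsOf H) ∧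
    (∀ v, vs.getLast? = some v → v = r ∨ v ∈ G.vertsOf H) ∧
    (∀ v ∈ vs, vs.head? ≠ some v → vs.getLast? ≠ some v → v ≠ r ∧ v ∉ G.vertsOf H)

/-- A minimal up chain: an up chain none of whose internal vertices lies in
`{r} ∪ V(H)`. -/
def IsMinimalUpChain (r : G.V) (H Hb C : Set G.E) : Prop :=
  G.IsMinimalOpenUpChain r H Hb C ∨
  ∃ v, G.IsClosedUpChain r H Hb C v ∧
    ∀ u ∈ G.vertsOf C, u ≠ v → u ≠ r ∧ u ∉ G.vertsOf H

/-- A minimal down chain: a down chain none of whose internal vertices lies in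
`{r} ∪ V(Hb)`. -/
def IsMinimalDownChain (r : G.V) (H Hb C : Set G.E) : Prop :=
  G.IsMinimalUpChain r Hb H C

/-- A minimal chain decomposition (of the part of `G` with edge set `F`):
a chain decomposition all of whose up chains and down chains are minimal. -/
def IsMinimalChainDecompOn (F : Set G.E) (r : G.V) {n : ℕ} (Gs : Fin n → Set G.E) : Prop :=
  G.IsChainDecompOn F r Gs ∧
  ∀ i, G.IsMinimalUpChain r (G.before Gs i) (G.after Gs i) (Gs i) ∨
       G.IsMinimalDownChain r (G.before Gs i) (G.after Gs i) (Gs i) ∨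
       G.IsOneWayChain r (G.before Gs i) (G.after Gs i) (Gs i)

/-- A minimal chain decomposition of `G` rooted at `r`. -/
def IsMinimalChainDecomp (r : G.V) {n : ℕ} (Gs : Fin n → Set G.E) : Prop :=
  G.IsMinimalChainDecompOn Set.univ r Gs

/-! ### Subgraphs, trees and edge-independence -/

/-- A subgraph of `G`: a set of vertices together with a set of edges all of whose
endpoints lie in the vertex set. -/
structure Sub (G : MG) where
  verts : Set G.V
  edges : Set G.E
  valid : ∀ e ∈ edges, ∀ v ∈ G.ends e, v ∈ verts

/-- A subgraph is connected. -/
def Sub.Connected {G : MG} (T : Sub G) : Prop :=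
  T.verts.Nonempty ∧ ∀ a ∈ T.verts, ∀ b ∈ T.verts,
    Relation.ReflTransGen (fun x y => ∃ e ∈ T.edges, G.ends e = s(x, y)) a b

/-- A subgraph is a tree: connected and containing no cycle. -/
def Sub.IsTree {G : MG} (T : Sub G) : Prop :=
  T.Connected ∧ ¬ ∃ v vs es, G.IsCycle v vs es ∧ ∀ e ∈ es, e ∈ T.edges

/-- A subgraph is spanning. -/
def Sub.Spanning {G : MG} (T : Sub G) : Prop := T.verts = Set.univ

/-- `vs, es` is a path from `a` to `b` all of whose edges lie in the subgraph `T`. -/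
def Sub.PathIn {G : MG} (T : Sub G) (a b : G.V) (vs : List G.V) (es : List G.E) : Prop :=
  G.IsPath vs es ∧ vs.head? = some a ∧ vs.getLast? = some b ∧ ∀ e ∈ es, e ∈ T.edges

/-- Two subtrees of `G` are edge-independent with root `r`: each contains `r`, and for
every common vertex `v`, the path between `r` and `v` in one tree is edge-disjoint from
the path between `r` and `v` in the other. -/
def EdgeIndependent (r : G.V) (T₁ T₂ : Sub G) : Prop :=
  r ∈ T₁.verts ∧ r ∈ T₂.verts ∧
  ∀ v ∈ T₁.verts ∩ T₂.verts, ∀ vs₁ es₁ vs₂ es₂,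
    T₁.PathIn r v vs₁ es₁ → T₂.PathIn r v vs₂ es₂ → ∀ e ∈ es₁, e ∉ es₂

/-- `G` has a set of four edge-independent spanning trees rooted at `r`. -/
def HasFourEIST (r : G.V) : Prop :=
  ∃ T : Fin 4 → Sub G, (∀ i, (T i).IsTree ∧ (T i).Spanning) ∧
    ∀ i j, i ≠ j → G.EdgeIndependent r (T i) (T j)

/-! ### Mader operations -/

/-- Add to `G` a new edge with the (not necessarily distinct) endpoints `p`. -/
def addEdge (p : Sym2 G.V) : MG :=
  ⟨G.V, Option G.E, fun e => e.elim p G.ends⟩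

/-- Pinch the two distinct edges `e₁` (with ends `x`, `y`) and `e₂` (with ends `z`, `w`):
delete `e₁` and `e₂`, add a new vertex (`none`), and add four new edges joining the new
vertex to `x`, `y`, `z`, `w` respectively. -/
def pinch (e₁ e₂ : G.E) (x y z w : G.V) : MG where
  V := Option G.V
  E := {e : G.E // e ≠ e₁ ∧ e ≠ e₂} ⊕ Fin 4
  ends := fun e =>
    Sum.elim (fun e' => (G.ends e'.1).map some)
      (fun i =>
        if i = 0 then s((none : Option G.V), some x)
        else if i = 1 then s((none : Option G.V), some y)
        else if i = 2 then s((none : Option G.V), some z)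
        else s((none : Option G.V), some w)) e

end MG

/-- A multigraph with a distinguished root vertex. -/
structure PMG : Type 1 where
  G : MG
  r : G.V

/-- A single Mader operation on a rooted multigraph: either add an edge, or pinch two
distinct edges. -/
inductive MaderStep : PMG → PMG → Prop
  | addEdge (P : PMG) (p : Sym2 P.G.V) : MaderStep P ⟨P.G.addEdge p, P.r⟩
  | pinch (P : PMG) (e₁ e₂ : P.G.E) (x y z w : P.G.V) (hne : e₁ ≠ e₂)
      (h₁ : P.G.ends e₁ = s(x, y)) (h₂ : P.G.ends e₂ = s(z, w)) :
      MaderStep P ⟨P.G.pinch e₁ e₂ x y z w, some P.r⟩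

/-- The starting graph `G⁰` of the Mader construction: two vertices joined by four
parallel edges, rooted at one of them. -/
def basePMG : PMG :=
  ⟨⟨Bool, Fin 4, fun _ => s(false, true)⟩, false⟩

/-- An isomorphism of rooted multigraphs: bijections on vertices and edges commuting
with the endpoint maps and sending root to root. -/
def PIso (P Q : PMG) : Prop :=
  ∃ (fV : P.G.V ≃ Q.G.V) (fE : P.G.E ≃ Q.G.E),
    (∀ e, Q.G.ends (fE e) = (P.G.ends e).map fV) ∧ fV P.r = Q.r

/-- `G`, rooted at `r`, can be built from `basePMG` by repeatedly performing
Mader operations. -/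
def MaderConstructible (G : MG) (r : G.V) : Prop :=
  ∃ Q : PMG, Relation.ReflTransGen MaderStep basePMG Q ∧ PIso Q ⟨G, r⟩

namespace MG

variable {G : MG}

theorem Reach.mono {F F' : Set G.E} (h : F ⊆ F') {a b : G.V} (hab : G.Reach F a b) :
    G.Reach F' a b :=
  Relation.ReflTransGen.mono (fun _ _ ⟨e, he, hx⟩ => ⟨e, h he, hx⟩) _ _ hab

theorem Reach.symm {F : Set G.E} {a b : G.V} (hab : G.Reach F a b) : G.Reach F b a := by
  induction hab with
  | refl => exact .refl
  | tail _ hs ih =>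
    obtain ⟨e, he, hx⟩ := hs
    exact .head ⟨e, he, by rw [hx, Sym2.eq_swap]⟩ ih

theorem Reach.trans {F : Set G.E} {a b c : G.V} (hab : G.Reach F a b) (hbc : G.Reach F b c) :
    G.Reach F a c :=
  Relation.ReflTransGen.trans hab hbc

theorem vertsOf_mono {F F' : Set G.E} (h : F ⊆ F') : G.vertsOf F ⊆ G.vertsOf F' :=
  fun _ ⟨e, he, hv⟩ => ⟨e, h he, hv⟩

theorem mem_vertsOf_union {F F' : Set G.E} {v : G.V} :
    v ∈ G.vertsOf (F ∪ F') ↔ v ∈ G.vertsOf F ∨ v ∈ G.vertsOf F' := by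
  constructor
  · rintro ⟨e, he | he, hv⟩
    · exact .inl ⟨e, he, hv⟩
    · exact .inr ⟨e, he, hv⟩
  · rintro (h | h)
    · exact vertsOf_mono Set.subset_union_left h
    · exact vertsOf_mono Set.subset_union_right h

theorem mem_vertsOf_of_two_le_deg {F : Set G.E} {v : G.V} (h : 2 ≤ G.deg F v) :
    v ∈ G.vertsOf F := by
  by_contra hv
  have h1 : {e ∈ F | v ∈ G.ends e} = ∅ :=
    Set.eq_empty_iff_forall_notMem.2 fun e he => hv ⟨e, he⟩
  have h2 : {e ∈ F | G.ends e = s(v, v)} = ∅ :=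
    Set.eq_empty_iff_forall_notMem.2 fun e he => hv ⟨e, he.1, by simp [he.2]⟩
  simp [deg, h1, h2] at h

theorem deg_le_one {F : Set G.E} {v : G.V} {e : G.E} (hl : G.ends e ≠ s(v, v))
    (h : ∀ e' ∈ F, e' ≠ e → v ∉ G.ends e') : G.deg F v ≤ 1 := by
  have h1 : {e ∈ F | v ∈ G.ends e} ⊆ {e} := by
    rintro e' ⟨he', hv⟩
    by_contra hne
    exact h e' he' hne hv
  have h2 : {e ∈ F | G.ends e = s(v, v)} = ∅ := by
    refine Set.eq_empty_iff_forall_notMem.2 ?_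
    rintro e' ⟨he', hv⟩
    obtain rfl : e' = e := h1 ⟨he', by simp [hv]⟩
    exact hl hv
  have := Set.ncard_le_ncard h1
  simpa [deg, h2] using this

theorem IsLink.mem_of_mem_ends : ∀ {vs : List G.V} {es : List G.E}, G.IsLink vs es →
    ∀ e ∈ es, ∀ v ∈ G.ends e, v ∈ vs
  | [], _, h => by simp [IsLink] at h
  | [_], [], _ => by simp
  | [_], _ :: _, h => by simp [IsLink] at h
  | _ :: _ :: _, [], _ => by simp
  | a :: b :: vs, f :: es, ⟨hf, h⟩ => by
    intro e he v hv
    rcases List.mem_cons.1 he with rfl | he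
    · rw [hf, Sym2.mem_iff] at hv
      rcases hv with rfl | rfl <;> simp
    · exact List.mem_cons_of_mem _ (h.mem_of_mem_ends e he v hv)

theorem IsLink.reach_head : ∀ {a : G.V} {vs : List G.V} {es : List G.E}, G.IsLink (a :: vs) es →
    ∀ w ∈ a :: vs, G.Reach {e | e ∈ es} w a
  | a, [], _, _ => by
    intro w hw
    obtain rfl : w = a := by simpa using hw
    exact .refl
  | _, _ :: _, [], h => by simp [IsLink] at h
  | a, b :: vs, f :: es, ⟨hf, h⟩ => by
    intro w hw
    rcases List.mem_cons.1 hw with rfl | hw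
    · exact .refl
    · refine ((h.reach_head w hw).mono fun e he => List.mem_cons_of_mem _ he).trans ?_
      exact .single ⟨f, List.mem_cons_self, by rw [hf, Sym2.eq_swap]⟩

theorem IsLink.reach_head_or_last (e : G.E) : ∀ {a : G.V} {vs : List G.V} {es : List G.E},
    G.IsLink (a :: vs) es → es.Nodup → ∀ z, (a :: vs).getLast? = some z → ∀ w ∈ a :: vs,
      G.Reach ({e | e ∈ es} \ {e}) w a ∨ G.Reach ({e | e ∈ es} \ {e}) w z
  | a, [], _, _, _ => by
    intro z _ w hw
    obtain rfl : w = a := by simpa using hw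
    exact .inl .refl
  | _, _ :: _, [], h, _ => by simp [IsLink] at h
  | a, b :: vs, f :: es, ⟨hf, h⟩, hn => by
    intro z hz w hw
    rw [List.getLast?_cons_cons] at hz
    obtain ⟨hfe, hn⟩ := List.nodup_cons.1 hn
    rcases List.mem_cons.1 hw with rfl | hw
    · exact .inl .refl
    have hsub : ({e | e ∈ es} \ {e} : Set G.E) ⊆ {e | e ∈ f :: es} \ {e} :=
      fun x hx => ⟨List.mem_cons_of_mem _ hx.1, hx.2⟩
    by_cases hef : f = e
    · subst hef
      have hsub' : ({e | e ∈ es} : Set G.E) ⊆ {e | e ∈ f :: es} \ {f} :=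
        fun x hx => ⟨List.mem_cons_of_mem _ hx, fun hxf => hfe (hxf ▸ hx)⟩
      have hzm : z ∈ b :: vs := List.mem_of_getLast? hz
      exact .inr (((h.reach_head w hw).trans (h.reach_head z hzm).symm).mono hsub')
    · rcases h.reach_head_or_last e hn z hz w hw with h1 | h1
      · refine .inl ((h1.mono hsub).trans (.single ⟨f, ⟨List.mem_cons_self, hef⟩, ?_⟩))
        rw [hf, Sym2.eq_swap]
      · exact .inr (h1.mono hsub)

theorem mem_of_root_or_two_le_deg {r : G.V} {H : Set G.E} {v : G.V}
    (h : v = r ∨ 2 ≤ G.deg H v) : v = r ∨ v ∈ G.vertsOf H :=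
  h.imp_right mem_vertsOf_of_two_le_deg

theorem IsDownChain.root_or_two_le_deg {r : G.V} {H Hb C : Set G.E}
    (hC : G.IsDownChain r H Hb C) {w : G.V} (hw : w ∈ G.vertsOf C) :
    w = r ∨ 2 ≤ G.deg H w := by
  obtain ⟨f, hf, hwf⟩ := hw
  rcases hC with ⟨-, -, vs, es, hp, -, rfl, hd, -⟩ | ⟨v, -, -, vs, es, hc, rfl, hd, -⟩
  · exact hd w (hp.2.2.mem_of_mem_ends f hf w hwf)
  · have := hc.2.2.2.mem_of_mem_ends f hf w hwf
    exact hd w (by simpa [or_comm, or_left_comm] using this)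

/-- Every vertex of a chain reaches, inside the chain, a vertex of `H` or the root while avoiding
any prescribed non-root vertex of degree less than two in `H`. -/
theorem IsChain.exists_reach_avoiding {r : G.V} {H Hb C : Set G.E} (hC : G.IsChain r H Hb C)
    {B : Set G.V} (hB : B.Subsingleton) (hBd : ∀ b ∈ B, ¬ (b = r ∨ 2 ≤ G.deg H b))
    {w : G.V} (hw : w ∈ G.vertsOf C) :
    ∃ x ∉ B, (x = r ∨ x ∈ G.vertsOf H) ∧ G.Reach C w x := by
  rcases hC with hC | hC | ⟨u, v, e, -, -, rfl, he, hu, -⟩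
  · obtain ⟨f, hf, hwf⟩ := hw
    rcases hC with ⟨-, -, vs, es, hp, hne, rfl, -, hh, hl⟩ | ⟨v, -, -, vs, es, hc, rfl, -, hv⟩
    · have hwm := hp.2.2.mem_of_mem_ends f hf w hwf
      obtain ⟨hnd, -, hlink⟩ := hp
      match vs, es, hne, hlink with
      | [_], _ :: _, _, hlink => simp [IsLink] at hlink
      | a :: b :: vs, f' :: es, _, hlink =>
        by_cases ha : a ∈ B
        · obtain ⟨z, hz⟩ : ∃ z, (b :: vs).getLast? = some z :=
            ⟨_, List.getLast?_eq_some_getLast (by simp)⟩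
          have hzm : z ∈ b :: vs := List.mem_of_getLast? hz
          refine ⟨z, fun hzB => ?_, hl z (by rw [List.getLast?_cons_cons, hz]), ?_⟩
          · obtain rfl := hB ha hzB
            exact (List.nodup_cons.1 hnd).1 hzm
          · exact (hlink.reach_head w hwm).trans
              (hlink.reach_head z (List.mem_cons_of_mem _ hzm)).symm
        · exact ⟨a, ha, hh a rfl, hlink.reach_head w hwm⟩
    · exact ⟨v, fun hvB => hBd v hvB hv, mem_of_root_or_two_le_deg hv,
        hc.2.2.2.reach_head w (hc.2.2.2.mem_of_mem_ends f hf w hwf)⟩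
  · have := hC.root_or_two_le_deg hw
    exact ⟨w, fun hwB => hBd w hwB this, mem_of_root_or_two_le_deg this, .refl⟩
  · refine ⟨u, fun huB => hBd u huB hu, mem_of_root_or_two_le_deg hu, ?_⟩
    obtain ⟨f, rfl, hwf⟩ := hw
    rw [he, Sym2.mem_iff] at hwf
    rcases hwf with rfl | rfl
    · exact .refl
    · exact .single ⟨f, rfl, by rw [he, Sym2.eq_swap]⟩

theorem IsChain.exists_reach_diff_or_oneWay {r : G.V} {H Hb C : Set G.E}
    (hC : G.IsChain r H Hb C) (e : G.E) :
    (∀ w ∈ G.vertsOf C, ∃ x, (x = r ∨ x ∈ G.vertsOf H) ∧ G.Reach (C \ {e}) w x) ∨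
      G.IsOneWayChain r H Hb C := by
  rcases hC with hC | hC | hC
  · refine .inl fun w ⟨f, hf, hwf⟩ => ?_
    rcases hC with ⟨-, -, vs, es, hp, hne, rfl, -, hh, hl⟩ | ⟨v, -, -, vs, es, hc, rfl, -, hv⟩
    · have hwm := hp.2.2.mem_of_mem_ends f hf w hwf
      obtain ⟨-, hnd, hlink⟩ := hp
      match vs, hlink with
      | a :: vs, hlink =>
        have hz := List.getLast?_eq_some_getLast (List.cons_ne_nil a vs)
        rcases hlink.reach_head_or_last e hnd _ hz w hwm with h | h
        · exact ⟨_, hh _ rfl, h⟩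
        · exact ⟨_, hl _ hz, h⟩
    · obtain ⟨-, hnd, -, hlink⟩ := hc
      have hwm := hlink.mem_of_mem_ends f hf w hwf
      refine ⟨v, mem_of_root_or_two_le_deg hv, ?_⟩
      have hz : (v :: (vs ++ [v])).getLast? = some v := by
        rw [← List.cons_append, List.getLast?_append]
        rfl
      exact (hlink.reach_head_or_last e hnd v hz w hwm).elim id id
  · exact .inl fun w hw => ⟨w, mem_of_root_or_two_le_deg (hC.root_or_two_le_deg hw), .refl⟩
  · exact .inr hC

theorem IsChain.symm {r : G.V} {H Hb C : Set G.E} (hC : G.IsChain r H Hb C) :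
    G.IsChain r Hb H C := by
  rcases hC with hC | hC | ⟨u, v, e, h1, h2, h3, h4, h5, h6⟩
  · exact .inr (.inl hC)
  · exact .inl hC
  · exact .inr (.inr ⟨v, u, e, h2, h1, h3, by rw [h4, Sym2.eq_swap], h6, h5⟩)

theorem IsOneWayChain.symm {r : G.V} {H Hb C : Set G.E} (hC : G.IsOneWayChain r H Hb C) :
    G.IsOneWayChain r Hb H C := by
  obtain ⟨u, v, e, h1, h2, h3, h4, h5, h6⟩ := hC
  exact ⟨v, u, e, h2, h1, h3, by rw [h4, Sym2.eq_swap], h6, h5⟩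

/-- `v` is a leaf of the edge set `H`, and `e` is its pendant edge; all other vertices of `H`
reach `r` without using `e`. -/
def IsPendantAt (r : G.V) (H : Set G.E) (e : G.E) (v : G.V) : Prop :=
  v ∈ G.ends e ∧ G.ends e ≠ s(v, v) ∧ (∀ e' ∈ H, e' ≠ e → v ∉ G.ends e') ∧
    ∀ w ∈ G.vertsOf H, w ≠ v → G.Reach (H \ {e}) w r

/-- All vertices of `H` reach `r` in `H`, and deleting an edge of `H` preserves this unless
it is a pendant edge satisfying `P`. -/
def IsRootedUpToPendant (P : G.E → Prop) (r : G.V) (H : Set G.E) : Prop :=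
  (∀ w ∈ G.vertsOf H, G.Reach H w r) ∧
    ∀ e ∈ H, (∀ w ∈ G.vertsOf H, G.Reach (H \ {e}) w r) ∨
      (P e ∧ ∃ v, G.IsPendantAt r H e v)

theorem IsRootedUpToPendant.union {P : G.E → Prop} {r : G.V} {H Hb C : Set G.E}
    (hH : IsRootedUpToPendant P r H) (hC : G.IsChain r H Hb C) (hdisj : Disjoint H C)
    (hP : G.IsOneWayChain r H Hb C → ∀ e ∈ C, P e) :
    IsRootedUpToPendant P r (H ∪ C) := by
  obtain ⟨hconn, hcut⟩ := hH
  have hextend : ∀ {F : Set G.E}, (∀ w ∈ G.vertsOf H, G.Reach F w r) → C ⊆ F →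
      ∀ w ∈ G.vertsOf (H ∪ C), G.Reach F w r := by
    intro F hF hCF w hw
    rcases mem_vertsOf_union.1 hw with hw | hw
    · exact hF w hw
    · obtain ⟨x, -, hx, hwx⟩ := hC.exists_reach_avoiding (B := ∅) (by simp) (by simp) hw
      refine (hwx.mono hCF).trans ?_
      rcases hx with rfl | hx
      · exact .refl
      · exact hF x hx
  refine ⟨hextend (fun w hw => (hconn w hw).mono Set.subset_union_left) Set.subset_union_right, ?_⟩
  intro e he
  by_cases heH : e ∈ H
  · have heC : e ∉ C := fun h => Set.disjoint_left.1 hdisj heH h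
    have hCF : C ⊆ (H ∪ C) \ {e} := fun x hx => ⟨.inr hx, fun h => heC (h ▸ hx)⟩
    have hHF : H \ {e} ⊆ (H ∪ C) \ {e} := Set.sdiff_subset_sdiff_left Set.subset_union_left
    rcases hcut e heH with hall | ⟨hPe, v, hve, hloop, hleaf, hrest⟩
    · exact .inl (hextend (fun w hw => (hall w hw).mono hHF) hCF)
    have hdeg := deg_le_one hloop hleaf
    by_cases hvr : v = r
    · refine .inl (hextend (fun w hw => ?_) hCF)
      by_cases hwv : w = v
      · rw [hwv, hvr]
        exact .refl
      · exact (hrest w hw hwv).mono hHF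
    have hCr : ∀ w ∈ G.vertsOf C, G.Reach ((H ∪ C) \ {e}) w r := by
      intro w hw
      obtain ⟨x, hxv, hx, hwx⟩ := hC.exists_reach_avoiding (B := {v}) (by simp)
        (by rintro b rfl; rintro (h | h) <;> [exact hvr h; omega]) hw
      refine (hwx.mono hCF).trans ?_
      rcases hx with rfl | hx
      · exact .refl
      · exact (hrest x hx hxv).mono hHF
    have hne : ∀ w ∈ G.vertsOf (H ∪ C), w ≠ v → G.Reach ((H ∪ C) \ {e}) w r := by
      intro w hw hwv
      rcases mem_vertsOf_union.1 hw with hw | hw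
      · exact (hrest w hw hwv).mono hHF
      · exact hCr w hw
    by_cases hvC : v ∈ G.vertsOf C
    · refine .inl fun w hw => ?_
      by_cases hwv : w = v
      · exact hwv ▸ hCr v hvC
      · exact hne w hw hwv
    · refine .inr ⟨hPe, v, hve, hloop, ?_, hne⟩
      rintro e' (he' | he') hee hv
      · exact hleaf e' he' hee hv
      · exact hvC ⟨e', he', hv⟩
  · have heC : e ∈ C := he.resolve_left heH
    have hHF : H ⊆ (H ∪ C) \ {e} := fun x hx => ⟨.inl hx, fun h => heH (h ▸ hx)⟩
    have hend : ∀ x, (x = r ∨ x ∈ G.vertsOf H) → G.Reach ((H ∪ C) \ {e}) x r := by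
      rintro x (rfl | hx)
      · exact .refl
      · exact (hconn x hx).mono hHF
    rcases hC.exists_reach_diff_or_oneWay e with h | h
    · refine .inl fun w hw => ?_
      rcases mem_vertsOf_union.1 hw with hw | hw
      · exact hend w (.inr hw)
      · obtain ⟨x, hx, hwx⟩ := h w hw
        exact (hwx.mono (Set.sdiff_subset_sdiff_left Set.subset_union_right)).trans (hend x hx)
    · have hPe := hP h e heC
      obtain ⟨u, v, f, -, -, rfl, hf, hu, -⟩ := h
      obtain rfl : e = f := heC
      have hu := mem_of_root_or_two_le_deg hu
      have hcov : ∀ w ∈ G.vertsOf (H ∪ {e}), w ≠ v → G.Reach ((H ∪ {e}) \ {e}) w r := by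
        intro w hw hwv
        rcases mem_vertsOf_union.1 hw with hw | ⟨f, rfl, hwf⟩
        · exact hend w (.inr hw)
        · rw [hf, Sym2.mem_iff] at hwf
          exact hend w (hwf.resolve_right hwv ▸ hu)
      by_cases hv : v = r ∨ v ∈ G.vertsOf H
      · refine .inl fun w hw => ?_
        by_cases hwv : w = v
        · exact hwv ▸ hend v hv
        · exact hcov w hw hwv
      · refine .inr ⟨hPe, v, by simp [hf], ?_, ?_, hcov⟩
        · intro hl
          have huv : u = v := by
            have : u ∈ s(v, v) := by rw [← hl, hf]; simp
            simpa using this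
          exact hv (huv ▸ hu)
        · rintro e' (he' | he') hee hve
          · exact hv (.inr ⟨e', he', hve⟩)
          · exact hee he'

theorem IsRootedUpToPendant.of_isCutEdge {P : G.E → Prop} {r : G.V} {H : Set G.E}
    (hH : IsRootedUpToPendant P r H) {e : G.E} (he : G.IsCutEdge H e) :
    P e ∧ ∃ v ∈ G.ends e, ∀ e' ∈ H, e' ≠ e → v ∉ G.ends e' := by
  obtain ⟨heH, a, ha, b, hb, hab⟩ := he
  rcases hH.2 e heH with h | ⟨hP, v, hv, -, hleaf, -⟩
  · exact (hab ((h a ha).trans (h b hb).symm)).elim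
  · exact ⟨hP, v, hv, hleaf⟩

theorem before_zero {n : ℕ} (Gs : Fin (n + 1) → Set G.E) : G.before Gs 0 = ∅ :=
  Set.eq_empty_iff_forall_notMem.2 fun _ ⟨_, hj, _⟩ => by simp at hj

theorem before_succ {n : ℕ} (Gs : Fin (n + 1) → Set G.E) (i : Fin n) :
    G.before Gs i.succ = G.before Gs i.castSucc ∪ Gs i.castSucc := by
  ext e
  constructor
  · rintro ⟨j, hj, he⟩
    rcases (Fin.le_castSucc_iff.2 hj).lt_or_eq with h | rfl
    · exact .inl ⟨j, h, he⟩
    · exact .inr he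
  · rintro (⟨j, hj, he⟩ | he)
    · exact ⟨j, Fin.le_castSucc_iff.1 hj.le, he⟩
    · exact ⟨_, Fin.castSucc_lt_succ, he⟩

theorem before_comp_rev {n : ℕ} (Gs : Fin n → Set G.E) (i : Fin n) :
    G.before (Gs ∘ Fin.rev) i = G.after Gs i.rev := by
  ext e
  constructor
  · rintro ⟨j, hj, he⟩
    exact ⟨j.rev, Fin.rev_lt_rev.2 hj, he⟩
  · rintro ⟨j, hj, he⟩
    exact ⟨j.rev, by rwa [← Fin.rev_lt_rev, Fin.rev_rev], by simpa using he⟩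

theorem after_comp_rev {n : ℕ} (Gs : Fin n → Set G.E) (i : Fin n) :
    G.after (Gs ∘ Fin.rev) i = G.before Gs i.rev := by
  have := before_comp_rev (Gs ∘ Fin.rev) i.rev
  rw [Fin.rev_rev] at this
  rw [← this]
  congr 1
  ext1 j
  simp

theorem IsChainDecomp.comp_rev {r : G.V} {n : ℕ} {Gs : Fin n → Set G.E}
    (h : G.IsChainDecomp r Gs) : G.IsChainDecomp r (Gs ∘ Fin.rev) := by
  obtain ⟨hd, hU, hc⟩ := h
  refine ⟨fun i j hij => hd _ _ (Fin.rev_injective.ne hij), ?_, fun i => ?_⟩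
  · rw [← hU]
    exact Fin.revPerm.surjective.iUnion_comp Gs
  · rw [before_comp_rev, after_comp_rev]
    exact (hc i.rev).symm

theorem IsChainDecomp.isRootedUpToPendant_before {r : G.V} {m : ℕ} {Gs : Fin (m + 1) → Set G.E}
    (h : G.IsChainDecomp r Gs) (i : Fin (m + 1)) :
    IsRootedUpToPendant (fun e => ∃ j, e ∈ Gs j ∧ Gs j = {e} ∧
      G.IsOneWayChain r (G.before Gs j) (G.after Gs j) (Gs j)) r (G.before Gs i) := by
  induction i using Fin.induction with
  | zero =>
    rw [before_zero]
    exact ⟨fun _ ⟨_, he, _⟩ => he.elim, fun _ he => he.elim⟩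
  | succ i ih =>
    rw [before_succ]
    refine ih.union (h.2.2 i.castSucc) ?_ fun how e he => ⟨_, he, ?_, how⟩
    · rw [Set.disjoint_left]
      rintro e ⟨j, hj, he⟩ he'
      exact Set.disjoint_left.1 (h.1 j _ hj.ne) he he'
    · obtain ⟨u, v, f, -, -, hC, -⟩ := how
      rw [hC] at he ⊢
      rw [Set.mem_singleton_iff.1 he]

end MG

theorem cut_edge_of_partial_chain_decomp (G : MG) [Finite G.V] [Finite G.E]
    (r : G.V) (m : ℕ) (Gs : Fin (m + 1) → Set G.E) (h : G.IsChainDecomp r Gs)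
    (i k : Fin (m + 1)) (hik : (k : ℕ) + 1 = (i : ℕ)) (e : G.E) :
    (G.IsCutEdge (G.before Gs i) e →
      (∃ j, e ∈ Gs j ∧ Gs j = {e} ∧
        G.IsOneWayChain r (G.before Gs j) (G.after Gs j) (Gs j)) ∧
      ∃ v ∈ G.ends e, ∀ e' ∈ G.before Gs i, e' ≠ e → v ∉ G.ends e') ∧
    (G.IsCutEdge (G.after Gs k) e →
      (∃ j, e ∈ Gs j ∧ Gs j = {e} ∧
        G.IsOneWayChain r (G.before Gs j) (G.after Gs j) (Gs j)) ∧
      ∃ v ∈ G.ends e, ∀ e' ∈ G.after Gs k, e' ≠ e → v ∉ G.ends e') := by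
  refine ⟨(h.isRootedUpToPendant_before i).of_isCutEdge, fun he => ?_⟩
  have hk : G.after Gs k = G.before (Gs ∘ Fin.rev) k.rev := by
    rw [MG.before_comp_rev, Fin.rev_rev]
  rw [hk] at he ⊢
  obtain ⟨⟨j, hej, hj, how⟩, hv⟩ :=
    (h.comp_rev.isRootedUpToPendant_before k.rev).of_isCutEdge he
  rw [MG.before_comp_rev, MG.after_comp_rev] at how
  exact ⟨⟨j.rev, hej, hj, how.symm⟩, hv⟩
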